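/- arXiv:2207.12799 — 2 statements merged into one kernel-verified Lean document; each statement's English description precedes it below -/
import Mathlib

section
/- Let A be a unital commutative C*-algebra, let d, n be positive natural numbers, and let ε > 0. If (τ_j)_{j=1}^n and (ω_j)_{j=1}^n are Parseval frames for the standard Hilbert A-module A^d with squared modular distance ‖∑_{j=1}^n ⟨τ_j − ω_j, τ_j − ω_j⟩‖ < ε, then the images under the respective analysis operators satisfy ‖∑_{j=1}^n ⟨θ_τ τ_j − θ_ω ω_j, θ_τ τ_j − θ_ω ω_j⟩‖ < 4ε. -/
open Finset

/-- The `A`-valued inner product on the standard Hilbert `A`-module `A^d`: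
`⟨x, y⟩ = ∑ i, x i * (y i)^*`. -/
def modInner {A : Type*} [Ring A] [StarRing A] {d : ℕ} (x y : Fin d → A) : A :=
  ∑ i, x i * star (y i)

/-- The analysis operator `θ_τ : A^d → A^n` of a family `τ` in `A^d`,
sending `x` to the tuple `(⟨x, τ_j⟩)_{j=1}^n`. -/
def analysisOp {A : Type*} [Ring A] [StarRing A] {d n : ℕ} (τ : Fin n → Fin d → A)
    (x : Fin d → A) : Fin n → A :=
  fun j => modInner x (τ j)

theorem star_modInner {A : Type*} [CommRing A] [StarRing A] {d : ℕ} (x y : Fin d → A) :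
    star (modInner x y) = modInner y x := by
  simp only [modInner, star_sum, star_mul, star_star]

theorem modInner_sub_left {A : Type*} [Ring A] [StarRing A] {d : ℕ} (x y z : Fin d → A) :
    modInner (x - y) z = modInner x z - modInner y z := by
  simp only [modInner, Pi.sub_apply, sub_mul, sum_sub_distrib]

theorem modInner_sub_right {A : Type*} [Ring A] [StarRing A] {d : ℕ} (x y z : Fin d → A) :
    modInner x (y - z) = modInner x y - modInner x z := by
  simp only [modInner, Pi.sub_apply, star_sub, mul_sub, sum_sub_distrib]

/-- A consequence of the parallelogram identity. -/
theorem add_mul_star_add_le {A : Type*} [Ring A] [StarRing A] [PartialOrder A]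
    [StarOrderedRing A] (a b : A) :
    (a + b) * star (a + b) ≤ 2 * (a * star a) + 2 * (b * star b) := by
  have h := mul_star_self_nonneg (a - b)
  rw [← sub_nonneg]
  convert h using 1
  simp only [star_add, star_sub]
  noncomm_ring

/-- Let `A` be a unital commutative C*-algebra, `d, n > 0` and `ε > 0`.  If `τ` and `ω` are
Parseval frames for `A^d` with squared modular distance
`‖∑ j ⟨τ_j - ω_j, τ_j - ω_j⟩‖ < ε`, then the images under the analysis operators satisfy
`‖∑ j ⟨θ_τ τ_j - θ_ω ω_j, θ_τ τ_j - θ_ω ω_j⟩‖ < 4 ε`. -/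
theorem analysis_dist_lt_four_eps {A : Type*} [CommCStarAlgebra A] [PartialOrder A]
    [StarOrderedRing A] {d n : ℕ} (hd : 0 < d) (hn : 0 < n) (ε : ℝ) (hε : 0 < ε)
    (τ ω : Fin n → Fin d → A)
    (hτ : ∀ x : Fin d → A,
      modInner x x = ∑ j, modInner x (τ j) * star (modInner x (τ j)))
    (hω : ∀ x : Fin d → A,
      modInner x x = ∑ j, modInner x (ω j) * star (modInner x (ω j)))
    (hdist : ‖∑ j, modInner (τ j - ω j) (τ j - ω j)‖ < ε) :
    ‖∑ j, modInner (analysisOp τ (τ j) - analysisOp ω (ω j))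
        (analysisOp τ (τ j) - analysisOp ω (ω j))‖ < 4 * ε := by
  have hsum : ∑ j, modInner (analysisOp τ (τ j) - analysisOp ω (ω j))
      (analysisOp τ (τ j) - analysisOp ω (ω j)) ≤
      4 * ∑ j, modInner (τ j - ω j) (τ j - ω j) := by
    calc
      _ ≤ ∑ j, ∑ k, (2 * (modInner (τ j - ω j) (τ k) * star (modInner (τ j - ω j) (τ k))) +
          2 * (modInner (ω j) (τ k - ω k) * star (modInner (ω j) (τ k - ω k)))) := by
        refine sum_le_sum fun j _ => sum_le_sum fun k _ => ?_
        have hsplit : (analysisOp τ (τ j) - analysisOp ω (ω j)) k =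
            modInner (τ j - ω j) (τ k) + modInner (ω j) (τ k - ω k) := by
          simp only [analysisOp, Pi.sub_apply, modInner_sub_left, modInner_sub_right]
          abel
        rw [hsplit]
        exact add_mul_star_add_le _ _
      _ = 2 * ∑ j, modInner (τ j - ω j) (τ j - ω j) +
          2 * ∑ k, modInner (τ k - ω k) (τ k - ω k) := by
        simp only [sum_add_distrib, ← mul_sum]
        congr 2
        · exact sum_congr rfl fun j _ => (hτ _).symm
        · rw [sum_comm]
          refine sum_congr rfl fun k _ => ?_
          rw [hω]
          refine sum_congr rfl fun j _ => ?_
          rw [star_modInner, star_modInner, mul_comm]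
      _ = _ := by ring
  have hnonneg : 0 ≤ ∑ j, modInner (analysisOp τ (τ j) - analysisOp ω (ω j))
      (analysisOp τ (τ j) - analysisOp ω (ω j)) :=
    sum_nonneg fun j _ => sum_nonneg fun k _ => mul_star_self_nonneg _
  calc
    _ ≤ ‖4 * ∑ j, modInner (τ j - ω j) (τ j - ω j)‖ :=
      CStarAlgebra.norm_le_norm_of_nonneg_of_le hnonneg hsum
    _ ≤ 4 * ‖∑ j, modInner (τ j - ω j) (τ j - ω j)‖ := by
      simpa [nsmul_eq_mul] using
        norm_nsmul_le (n := 4) (a := ∑ j, modInner (τ j - ω j) (τ j - ω j))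
    _ < 4 * ε := by linarith
end

section
/- (Hamilton–Moitra Theorem.) For every ε ∈ (0,1), all positive natural numbers n, d, and every ε-nearly equal norm Parseval frame (τ_j)_{j=1}^n for ℝ^d, there is an equal norm Parseval frame (ω_j)_{j=1}^n for ℝ^d satisfying ∑_{j=1}^n ‖τ_j − ω_j‖² ≤ 20 · ε · d². -/
open Finset RealInnerProductSpace

/-- The number of indices at which `m` is strictly smaller than at `k`. -/
noncomputable def strictRank {ι : Type*} [Fintype ι] (m : ι → ℝ) (k : ι) : ℕ :=
  #{l | m l < m k}

lemma strictRank_le {ι : Type*} [Fintype ι] (m : ι → ℝ) (k : ι) :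
    strictRank m k ≤ Fintype.card ι :=
  card_le_univ _

lemma sum_sub_sq_le_sum_strictRank {ι : Type*} [Fintype ι] (m x : ι → ℝ) {r : ℝ} (hr : 0 < r)
    (hm : ∀ k, 0 ≤ m k) (h : ∑ k, (m k * x k / r) ^ 2 = ∑ k, x k ^ 2) :
    ∑ k, (x k - m k * x k / r) ^ 2 ≤
      2 * ∑ k, (strictRank m k : ℝ) * ((m k * x k / r) ^ 2 - x k ^ 2) := by
  set p : ℕ := #{l | m l < r}
  have key : ∀ k, (x k - m k * x k / r) ^ 2 ≤
      2 * ((strictRank m k : ℝ) - p + 1 / 2) * ((m k * x k / r) ^ 2 - x k ^ 2) := by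
    intro k
    have hg : 0 ≤ m k / r := div_nonneg (hm k) hr.le
    obtain hk | hk := le_or_gt r (m k)
    · have hp : (p : ℝ) ≤ strictRank m k := by
        refine Nat.cast_le.mpr (card_le_card fun l hl => ?_)
        simp only [mem_filter, mem_univ, true_and] at hl ⊢
        exact hl.trans_le hk
      have h1 : 1 ≤ m k / r := (one_le_div hr).2 hk
      have h2 : 0 ≤ (m k * x k / r) ^ 2 - x k ^ 2 := by
        have : (m k * x k / r) ^ 2 - x k ^ 2 = ((m k / r) ^ 2 - 1) * x k ^ 2 := by ring
        rw [this]
        exact mul_nonneg (by nlinarith) (sq_nonneg _)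
      calc (x k - m k * x k / r) ^ 2 = (1 - m k / r) ^ 2 * x k ^ 2 := by ring
        _ ≤ ((m k / r) ^ 2 - 1) * x k ^ 2 :=
          mul_le_mul_of_nonneg_right (by nlinarith) (sq_nonneg _)
        _ = (m k * x k / r) ^ 2 - x k ^ 2 := by ring
        _ ≤ _ := le_mul_of_one_le_left h2 (by linarith)
    · have hp : (strictRank m k : ℝ) + 1 ≤ p := by
        have : strictRank m k < p := by
          refine card_lt_card ⟨fun l hl => ?_, fun hsub => ?_⟩
          · simp only [mem_filter, mem_univ, true_and] at hl ⊢
            exact hl.trans hk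
          · have := hsub (show k ∈ _ by simpa using hk)
            simp at this
        exact_mod_cast this
      have h1 : m k / r ≤ 1 := (div_le_one hr).2 hk.le
      have h2 : 0 ≤ x k ^ 2 - (m k * x k / r) ^ 2 := by
        have : x k ^ 2 - (m k * x k / r) ^ 2 = (1 - (m k / r) ^ 2) * x k ^ 2 := by ring
        rw [this]
        exact mul_nonneg (by nlinarith) (sq_nonneg _)
      calc (x k - m k * x k / r) ^ 2 = (1 - m k / r) ^ 2 * x k ^ 2 := by ring
        _ ≤ (1 - (m k / r) ^ 2) * x k ^ 2 :=
          mul_le_mul_of_nonneg_right (by nlinarith) (sq_nonneg _)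
        _ = x k ^ 2 - (m k * x k / r) ^ 2 := by ring
        _ ≤ (2 * ((p : ℝ) - strictRank m k - 1 / 2)) * (x k ^ 2 - (m k * x k / r) ^ 2) :=
          le_mul_of_one_le_left h2 (by linarith)
        _ = _ := by ring
  calc ∑ k, (x k - m k * x k / r) ^ 2
      ≤ ∑ k, 2 * ((strictRank m k : ℝ) - p + 1 / 2) * ((m k * x k / r) ^ 2 - x k ^ 2) :=
        sum_le_sum fun k _ => key k
    _ = ∑ k, (2 * ((strictRank m k : ℝ) * ((m k * x k / r) ^ 2 - x k ^ 2)) +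
          (1 - 2 * p) * ((m k * x k / r) ^ 2 - x k ^ 2)) := sum_congr rfl fun k _ => by ring
    _ = _ := by
      rw [sum_add_distrib, ← mul_sum, ← mul_sum, sum_sub_distrib, h]
      ring

/-- A product of at least `d` positive numbers is bounded below as soon as all products of
exactly `d` of them are. -/
lemma pow_card_le_prod_of_forall_card_eq {ι : Type*} [DecidableEq ι] {d : ℕ} (hd : 0 < d)
    {q : ι → ℝ} (hq : ∀ i, 0 ≤ q i) {c : ℝ} (hc : 0 < c) (hc1 : c ≤ 1)
    (h : ∀ S : Finset ι, #S = d → c ≤ ∏ i ∈ S, q i) (T : Finset ι) (hT : d ≤ #T) :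
    c ^ #T ≤ ∏ i ∈ T, q i := by
  obtain ⟨k, hk⟩ := Nat.exists_eq_add_of_le hT
  clear hT
  induction k generalizing T with
  | zero =>
    exact (pow_le_of_le_one hc.le hc1 (by omega)).trans (h T (by simpa using hk))
  | succ k ih =>
    obtain ⟨j, hj, hmax⟩ := T.exists_max_image q (card_pos.1 (by omega))
    have hcj : c ≤ q j := by
      by_contra! hlt
      obtain ⟨S, hST, hS⟩ := exists_subset_card_eq (show d ≤ #T by omega)
      have h1 : ∏ i ∈ S, q i ≤ q j ^ d := by
        rw [← hS, ← prod_const]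
        exact prod_le_prod (fun i _ => hq i) fun i hi => hmax i (hST hi)
      have h2 : q j ^ d ≤ q j := pow_le_of_le_one (hq j) (hlt.le.trans hc1) hd.ne'
      linarith [h S hS]
    have hcard : #(T.erase j) = d + k := by rw [card_erase_of_mem hj]; omega
    have := ih (T.erase j) hcard
    rw [← mul_prod_erase T q hj, show #T = #(T.erase j) + 1 by omega, pow_succ']
    exact mul_le_mul hcj this (by positivity) (hq j)

/-- A linear bijection maps some orthonormal basis to an orthogonal one. -/
lemma exists_orthonormalBasis_map_eq_smul {d : ℕ} [NeZero d]
    (M : EuclideanSpace ℝ (Fin d) →ₗ[ℝ] EuclideanSpace ℝ (Fin d)) (hM : Function.Injective M) :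
    ∃ (e f : OrthonormalBasis (Fin d) ℝ (EuclideanSpace ℝ (Fin d))) (m : Fin d → ℝ),
      (∀ k, 0 < m k) ∧ ∀ k, M (e k) = m k • f k := by
  have hn : Module.finrank ℝ (EuclideanSpace ℝ (Fin d)) = d := by simp
  have hS : (M.adjoint ∘ₗ M).IsSymmetric := by
    intro x y
    simp [LinearMap.adjoint_inner_left, LinearMap.adjoint_inner_right]
  set e := hS.eigenvectorBasis hn
  have hpos : ∀ k, 0 < ‖M (e k)‖ := fun k => norm_pos_iff.2 fun h0 =>
    e.orthonormal.ne_zero k (hM (by rw [h0, map_zero]))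
  have hon : Orthonormal ℝ fun k => (‖M (e k)‖)⁻¹ • M (e k) := by
    refine ⟨fun k => ?_, fun k l hkl => ?_⟩
    · rw [norm_smul, norm_inv, norm_norm, inv_mul_cancel₀ (hpos k).ne']
    · have : ⟪M (e k), M (e l)⟫ = 0 := by
        rw [← LinearMap.adjoint_inner_right, ← LinearMap.comp_apply]
        simp only [e]
        rw [hS.apply_eigenvectorBasis, inner_smul_right, e.orthonormal.2 hkl, mul_zero]
      simp [inner_smul_left, inner_smul_right, this]
  let b := basisOfOrthonormalOfCardEqFinrank hon (by simp)
  have hb : ⇑b = fun k => (‖M (e k)‖)⁻¹ • M (e k) :=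
    coe_basisOfOrthonormalOfCardEqFinrank hon (by simp)
  refine ⟨e, b.toOrthonormalBasis (by rw [hb]; exact hon), fun k => ‖M (e k)‖, hpos, fun k => ?_⟩
  rw [Module.Basis.coe_toOrthonormalBasis, hb]
  simp only
  rw [smul_smul, mul_inv_cancel₀ (hpos k).ne', one_smul]


/-- Hadamard's inequality for the image of a family under a linear map. -/
lemma abs_det_mul_abs_det_le_prod_norm {d : ℕ}
    (M : EuclideanSpace ℝ (Fin d) →L[ℝ] EuclideanSpace ℝ (Fin d))
    (w : Fin d → EuclideanSpace ℝ (Fin d)) :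
    |M.det| * |(EuclideanSpace.basisFun (Fin d) ℝ).toBasis.det w| ≤ ∏ k, ‖M (w k)‖ := by
  have : Fact (Module.finrank ℝ (EuclideanSpace ℝ (Fin d)) = d) := ⟨by simp⟩
  set b := EuclideanSpace.basisFun (Fin d) ℝ
  have h := b.toBasis.orientation.abs_volumeForm_apply_le (M ∘ w)
  rw [Orientation.volumeForm_robust' _ b] at h
  have h2 := b.toBasis.det_comp (M : EuclideanSpace ℝ (Fin d) →ₗ[ℝ] EuclideanSpace ℝ (Fin d)) w
  rw [ContinuousLinearMap.coe_coe] at h2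
  rw [h2, abs_mul] at h
  exact h

/-- Every subfamily of size `d` of the family `v` in `ℝ^d` is a basis. -/
def IsGeneric {n d : ℕ} (v : Fin n → EuclideanSpace ℝ (Fin d)) : Prop :=
  ∀ σ : Fin d → Fin n, Function.Injective σ →
    (EuclideanSpace.basisFun (Fin d) ℝ).toBasis.det (v ∘ σ) ≠ 0

lemma IsGeneric.span_eq_top {n d : ℕ} {v : Fin n → EuclideanSpace ℝ (Fin d)} (hv : IsGeneric v)
    (hdn : d ≤ n) : Submodule.span ℝ (Set.range v) = ⊤ := by
  have h := ((EuclideanSpace.basisFun (Fin d) ℝ).toBasis.is_basis_iff_det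
    (v := v ∘ Fin.castLE hdn)).2 (isUnit_iff_ne_zero.2 (hv _ (Fin.castLE_injective hdn)))
  exact eq_top_iff.2 (h.2.ge.trans (Submodule.span_mono (Set.range_comp_subset_range _ _)))

lemma IsGeneric.ne_zero {n d : ℕ} [NeZero d] {v : Fin n → EuclideanSpace ℝ (Fin d)}
    (hv : IsGeneric v) (hdn : d ≤ n) (i : Fin n) : v i ≠ 0 := by
  have h := ((EuclideanSpace.basisFun (Fin d) ℝ).toBasis.is_basis_iff_det
    (v := v ∘ (Equiv.swap (Fin.castLE hdn 0) i ∘ Fin.castLE hdn))).2 (isUnit_iff_ne_zero.2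
      (hv _ ((Equiv.injective _).comp (Fin.castLE_injective hdn))))
  simpa using h.1.ne_zero (0 : Fin d)

lemma IsGeneric.exists_pos_le_prod_norm {n d : ℕ} {v : Fin n → EuclideanSpace ℝ (Fin d)}
    (hv : IsGeneric v) (hdn : d ≤ n) :
    ∃ c > 0, c ≤ 1 ∧ ∀ M : EuclideanSpace ℝ (Fin d) →L[ℝ] EuclideanSpace ℝ (Fin d),
      M.det = 1 → ∀ S : Finset (Fin n), #S = d → c ≤ ∏ i ∈ S, ‖M (v i)‖ := by
  have : Nonempty {σ : Fin d → Fin n // Function.Injective σ} :=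
    ⟨⟨_, Fin.castLE_injective hdn⟩⟩
  obtain ⟨σ₀, hσ₀⟩ := Finite.exists_min fun σ : {σ : Fin d → Fin n // Function.Injective σ} =>
    |(EuclideanSpace.basisFun (Fin d) ℝ).toBasis.det (v ∘ σ.1)|
  refine ⟨min 1 |(EuclideanSpace.basisFun (Fin d) ℝ).toBasis.det (v ∘ σ₀.1)|,
    lt_min one_pos (abs_pos.2 (hv _ σ₀.2)), min_le_left _ _, fun M hM S hS => ?_⟩
  have h := abs_det_mul_abs_det_le_prod_norm M (v ∘ S.orderEmbOfFin hS)
  have hprod : ∏ i ∈ S, ‖M (v i)‖ = ∏ k, ‖M ((v ∘ S.orderEmbOfFin hS) k)‖ := by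
    conv_lhs => rw [← S.map_orderEmbOfFin_univ hS, prod_map]
    rfl
  rw [hprod]
  rw [hM, abs_one, one_mul] at h
  exact (min_le_right _ _).trans ((hσ₀ ⟨_, (S.orderEmbOfFin hS).injective⟩).trans h)

lemma IsGeneric.exists_forall_prod_norm_le {n d : ℕ} [NeZero d]
    {v : Fin n → EuclideanSpace ℝ (Fin d)} (hv : IsGeneric v) (hdn : d < n) :
    ∃ M : EuclideanSpace ℝ (Fin d) →L[ℝ] EuclideanSpace ℝ (Fin d), M.det = 1 ∧
      ∀ N : EuclideanSpace ℝ (Fin d) →L[ℝ] EuclideanSpace ℝ (Fin d), N.det = 1 →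
        ∏ i, ‖M (v i)‖ ≤ ∏ i, ‖N (v i)‖ := by
  obtain ⟨c, hc, hc1, hle⟩ := hv.exists_pos_le_prod_norm hdn.le
  let K : Set (EuclideanSpace ℝ (Fin d) →L[ℝ] EuclideanSpace ℝ (Fin d)) :=
    {M | M.det = 1 ∧ ∏ i, ‖M (v i)‖ ≤ ∏ i, ‖v i‖}
  have hcont : Continuous fun M : EuclideanSpace ℝ (Fin d) →L[ℝ] EuclideanSpace ℝ (Fin d) =>
      ∏ i, ‖M (v i)‖ := by fun_prop
  have hclosed : IsClosed K :=
    (isClosed_eq ContinuousLinearMap.continuous_det continuous_const).inter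
      (isClosed_le hcont continuous_const)
  have hid : ContinuousLinearMap.id ℝ (EuclideanSpace ℝ (Fin d)) ∈ K := by
    refine ⟨?_, le_of_eq rfl⟩
    simp [ContinuousLinearMap.det]
  let L : (EuclideanSpace ℝ (Fin d) →L[ℝ] EuclideanSpace ℝ (Fin d)) →ₗ[ℝ]
      (Fin n → EuclideanSpace ℝ (Fin d)) :=
    { toFun := fun M i => M (v i)
      map_add' := fun _ _ => rfl
      map_smul' := fun _ _ => rfl }
  have hL : LinearMap.ker L = ⊥ := by
    refine LinearMap.ker_eq_bot'.2 fun M hM => ?_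
    refine ContinuousLinearMap.coe_injective (LinearMap.ext_on_range (hv.span_eq_top hdn.le) ?_)
    exact fun i => congrFun hM i
  obtain ⟨C, -, hC⟩ := L.exists_antilipschitzWith hL
  have hbdd : Bornology.IsBounded K := by
    refine (hC.isBounded_preimage (Metric.isBounded_closedBall (x := 0)
      (r := (∏ i, ‖v i‖) / c ^ (n - 1)))).subset fun M hM => ?_
    have hnonneg : 0 ≤ (∏ i, ‖v i‖) / c ^ (n - 1) := by positivity
    rw [Set.mem_preimage, mem_closedBall_zero_iff, pi_norm_le_iff_of_nonneg hnonneg]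
    intro j
    have hcard : #((univ : Finset (Fin n)).erase j) = n - 1 := by simp
    have h1 := pow_card_le_prod_of_forall_card_eq (NeZero.pos d) (fun i => norm_nonneg (M (v i)))
      hc hc1 (hle M hM.1) (univ.erase j) (by omega)
    rw [hcard] at h1
    rw [le_div_iff₀ (by positivity)]
    calc ‖M (v j)‖ * c ^ (n - 1) ≤ ‖M (v j)‖ * ∏ i ∈ univ.erase j, ‖M (v i)‖ := by gcongr
      _ = ∏ i, ‖M (v i)‖ := mul_prod_erase univ (fun i => ‖M (v i)‖) (mem_univ j)
      _ ≤ _ := hM.2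
  have : ProperSpace (EuclideanSpace ℝ (Fin d) →L[ℝ] EuclideanSpace ℝ (Fin d)) :=
    FiniteDimensional.proper ℝ _
  obtain ⟨M, hMK, hM⟩ := (Metric.isCompact_of_isClosed_isBounded hclosed hbdd).exists_isMinOn
    ⟨_, hid⟩ hcont.continuousOn
  refine ⟨M, hMK.1, fun N hN => ?_⟩
  obtain h | h := le_or_gt (∏ i, ‖N (v i)‖) (∏ i, ‖v i‖)
  · exact hM ⟨hN, h⟩
  · exact hMK.2.trans h.le

/-- A linear map of determinant one minimizing the product of the norms of the images of a family
puts this family in radial isotropic position. -/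
lemma sum_inner_sq_div_norm_sq_of_forall_prod_norm_le {n d : ℕ} [NeZero d]
    {v : Fin n → EuclideanSpace ℝ (Fin d)} (hv : ∀ i, v i ≠ 0)
    {M : EuclideanSpace ℝ (Fin d) →L[ℝ] EuclideanSpace ℝ (Fin d)} (hM : M.det = 1)
    (hmin : ∀ N : EuclideanSpace ℝ (Fin d) →L[ℝ] EuclideanSpace ℝ (Fin d), N.det = 1 →
        ∏ i, ‖M (v i)‖ ≤ ∏ i, ‖N (v i)‖)
    {x : EuclideanSpace ℝ (Fin d)} (hx : ‖x‖ = 1) :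
    ∑ i, ⟪x, M (v i)⟫ ^ 2 / ‖M (v i)‖ ^ 2 = (n : ℝ) / d := by
  have hinj : ∀ N : EuclideanSpace ℝ (Fin d) →L[ℝ] EuclideanSpace ℝ (Fin d), N.det = 1 →
      ∀ i, 0 < ‖N (v i)‖ := by
    intro N hN i
    have hu : IsUnit (N : EuclideanSpace ℝ (Fin d) →ₗ[ℝ] EuclideanSpace ℝ (Fin d)) :=
      (LinearMap.isUnit_iff_isUnit_det _).2 (by
        rw [show LinearMap.det (N : EuclideanSpace ℝ (Fin d) →ₗ[ℝ] EuclideanSpace ℝ (Fin d)) = 1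
          from hN]; exact isUnit_one)
    have hi := ((Module.End.isUnit_iff _).1 hu).1
    exact norm_pos_iff.2 fun h0 => hv i (hi (by simpa using h0))
  have hd : (d : ℝ) ≠ 0 := Nat.cast_ne_zero.2 (NeZero.ne d)
  set w : Fin n → EuclideanSpace ℝ (Fin d) := fun i => M (v i) with hw
  let N : ℝ → (EuclideanSpace ℝ (Fin d) →L[ℝ] EuclideanSpace ℝ (Fin d)) := fun s =>
    LinearMap.toContinuousLinearMap (Real.exp (-s) •
      LinearMap.transvection ((Real.exp (d * s) - 1) • innerₗ _ x) x) ∘L M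
  have hNdet : ∀ s, (N s).det = 1 := by
    intro s
    have h1 : (N s).det = LinearMap.det (Real.exp (-s) •
        LinearMap.transvection ((Real.exp (d * s) - 1) • innerₗ _ x) x) * M.det :=
      LinearMap.det_comp _ _
    rw [h1, hM, LinearMap.det_smul, LinearMap.transvection.det]
    simp only [finrank_euclideanSpace, Fintype.card_fin, LinearMap.smul_apply, innerₗ_apply_apply,
      real_inner_self_eq_norm_sq, hx, ← Real.exp_nat_mul, smul_eq_mul, one_pow, mul_one]
    rw [add_sub_cancel, ← Real.exp_add]
    simp
  let h : Fin n → ℝ → ℝ := fun i s =>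
    Real.exp (-2 * s) * (‖w i‖ ^ 2 + (Real.exp (2 * d * s) - 1) * ⟪x, w i⟫ ^ 2)
  have hN : ∀ s i, ‖N s (v i)‖ ^ 2 = h i s := by
    intro s i
    have h1 : N s (v i) = Real.exp (-s) • (w i + ((Real.exp (d * s) - 1) * ⟪x, w i⟫) • x) := by
      simp [N, hw, LinearMap.transvection.apply]
    have e1 : Real.exp (-2 * s) = Real.exp (-s) ^ 2 := by
      rw [← Real.exp_nat_mul]; congr 1; push_cast; ring
    have e2 : Real.exp (2 * d * s) = Real.exp (d * s) ^ 2 := by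
      rw [← Real.exp_nat_mul]; congr 1; push_cast; ring
    rw [h1, norm_smul, mul_pow, Real.norm_eq_abs, sq_abs, norm_add_sq_real, norm_smul, hx,
      inner_smul_right, real_inner_comm x (w i)]
    simp only [h, e1, e2, Real.norm_eq_abs, mul_one, sq_abs]
    ring
  have hpos : ∀ i s, 0 < h i s := fun i s => by
    rw [← hN]; exact pow_pos (hinj _ (hNdet s) i) 2
  have hderiv : HasDerivAt (fun s => ∑ i, Real.log (h i s))
      (∑ i, (-2 * ‖w i‖ ^ 2 + 2 * d * ⟪x, w i⟫ ^ 2) / ‖w i‖ ^ 2) 0 := by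
    refine HasDerivAt.fun_sum fun i _ => ?_
    have h0 : h i 0 = ‖w i‖ ^ 2 := by simp [h]
    have hh : HasDerivAt (h i) (-2 * ‖w i‖ ^ 2 + 2 * d * ⟪x, w i⟫ ^ 2) 0 := by
      have e1 : HasDerivAt (fun s : ℝ => Real.exp (-2 * s)) (-2) 0 := by
        simpa using ((hasDerivAt_id (0 : ℝ)).const_mul (-2)).exp
      have e2 : HasDerivAt (fun s : ℝ => Real.exp (2 * d * s)) (2 * d) 0 := by
        simpa using ((hasDerivAt_id (0 : ℝ)).const_mul (2 * (d : ℝ))).exp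
      refine (e1.mul (((e2.sub_const 1).mul_const (⟪x, w i⟫ ^ 2)).const_add
        (‖w i‖ ^ 2))).congr_deriv ?_
      simp
    exact (hh.log (hpos i 0).ne').congr_deriv (by rw [h0])
  have hlocal : IsLocalMin (fun s => ∑ i, Real.log (h i s)) 0 := by
    refine Filter.Eventually.of_forall fun s => ?_
    simp only
    rw [← Real.log_prod fun i _ => (hpos i 0).ne', ← Real.log_prod fun i _ => (hpos i s).ne']
    refine Real.log_le_log (prod_pos fun i _ => hpos i 0) ?_
    have h0 : ∀ i, h i 0 = ‖w i‖ ^ 2 := by simp [h]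
    simp only [h0, ← hN, prod_pow]
    exact pow_le_pow_left₀ (prod_nonneg fun i _ => norm_nonneg _) (hmin _ (hNdet s)) 2
  have hzero := hlocal.hasDerivAt_eq_zero hderiv
  have hterm : ∀ i, (-2 * ‖w i‖ ^ 2 + 2 * d * ⟪x, w i⟫ ^ 2) / ‖w i‖ ^ 2 =
      -2 + 2 * d * (⟪x, w i⟫ ^ 2 / ‖w i‖ ^ 2) := by
    intro i
    have := (hinj M hM i).ne'
    change ‖w i‖ ≠ 0 at this
    field_simp
  simp only [hterm, sum_add_distrib, ← mul_sum, sum_const, card_univ, Fintype.card_fin,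
    nsmul_eq_mul] at hzero
  rw [eq_div_iff hd]
  linarith

/-- A generic family can be put in radial isotropic position by a linear bijection. -/
lemma IsGeneric.exists_radial_isotropic {n d : ℕ} [NeZero d]
    {v : Fin n → EuclideanSpace ℝ (Fin d)} (hv : IsGeneric v) (hdn : d ≤ n) :
    ∃ M : EuclideanSpace ℝ (Fin d) →ₗ[ℝ] EuclideanSpace ℝ (Fin d), Function.Injective M ∧
      ∀ x, ∑ i, ⟪x, M (v i)⟫ ^ 2 / ‖M (v i)‖ ^ 2 = (n : ℝ) / d * ‖x‖ ^ 2 := by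
  obtain rfl | hlt := hdn.eq_or_lt
  · have h := ((EuclideanSpace.basisFun (Fin d) ℝ).toBasis.is_basis_iff_det
      (v := v)).2 (isUnit_iff_ne_zero.2 (hv id Function.injective_id))
    let b := Module.Basis.mk h.1 h.2.ge
    let f := EuclideanSpace.basisFun (Fin d) ℝ
    refine ⟨b.equiv f.toBasis (Equiv.refl _), LinearEquiv.injective _, fun x => ?_⟩
    have hb : ∀ i, b.equiv f.toBasis (Equiv.refl _) (v i) = f i := fun i => by
      rw [show v i = b i by simp [b], Module.Basis.equiv_apply]
      simp
    have hd : (d : ℝ) ≠ 0 := Nat.cast_ne_zero.2 (NeZero.ne d)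
    simp only [LinearEquiv.coe_coe, hb, f.orthonormal.1, one_pow, div_one]
    rw [div_self hd, one_mul]
    exact f.sum_sq_inner_left x
  · obtain ⟨M, hM, hmin⟩ := hv.exists_forall_prod_norm_le hlt
    have hu : IsUnit (M : EuclideanSpace ℝ (Fin d) →ₗ[ℝ] EuclideanSpace ℝ (Fin d)) :=
      (LinearMap.isUnit_iff_isUnit_det _).2 (by
        rw [show LinearMap.det (M : EuclideanSpace ℝ (Fin d) →ₗ[ℝ] EuclideanSpace ℝ (Fin d)) = 1
          from hM]; exact isUnit_one)
    refine ⟨M, ((Module.End.isUnit_iff _).1 hu).1, fun x => ?_⟩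
    obtain rfl | hx := eq_or_ne x 0
    · simp
    · have hx' : ‖x‖ ≠ 0 := norm_ne_zero_iff.2 hx
      rw [← sum_inner_sq_div_norm_sq_of_forall_prod_norm_le (hv.ne_zero hdn) hM hmin
        (norm_smul_inv_norm (𝕜 := ℝ) hx), sum_mul]
      refine sum_congr rfl fun i _ => ?_
      simp only [ContinuousLinearMap.coe_coe, inner_smul_left]
      simp
      field_simp

lemma sum_inner_smul_eq_self_of_forall_sum_inner_sq {n d : ℕ}
    {ω : Fin n → EuclideanSpace ℝ (Fin d)} (h : ∀ x, ∑ j, ⟪x, ω j⟫ ^ 2 = ‖x‖ ^ 2)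
    (x : EuclideanSpace ℝ (Fin d)) : ∑ j, ⟪x, ω j⟫ • ω j = x := by
  let T : EuclideanSpace ℝ (Fin d) →ₗ[ℝ] EuclideanSpace ℝ (Fin d) :=
    ∑ j, (innerₗ _ (ω j)).smulRight (ω j) - LinearMap.id
  have hTx : ∀ y, T y = ∑ j, ⟪y, ω j⟫ • ω j - y := fun y => by
    simp [T, real_inner_comm]
  have hT : T.IsSymmetric := fun y z => by
    simp only [hTx, inner_sub_left, inner_sub_right, sum_inner, inner_sum, inner_smul_left,
      inner_smul_right]
    simp [mul_comm, real_inner_comm]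
  have hzero : T = 0 := hT.inner_map_self_eq_zero.1 fun y => by
    simp only [hTx, inner_sub_left, sum_inner, inner_smul_left, real_inner_self_eq_norm_sq, ← h y]
    simp [pow_two, real_inner_comm]
  exact sub_eq_zero.1 (by rw [← hTx, hzero, LinearMap.zero_apply])

/-- Arbitrarily small perturbations along the moment curve make a family generic. -/
lemma exists_forall_eventually_isGeneric_add_smul {n d : ℕ}
    (τ : Fin n → EuclideanSpace ℝ (Fin d)) :
    ∃ p : Fin n → EuclideanSpace ℝ (Fin d),
      ∀ᶠ s : ℝ in nhdsWithin 0 {0}ᶜ, IsGeneric fun i => τ i + s • p i := by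
  let p : Fin n → EuclideanSpace ℝ (Fin d) := fun i =>
    WithLp.toLp 2 fun k => ((i : ℕ) : ℝ) ^ (k : ℕ)
  refine ⟨p, ?_⟩
  simp only [IsGeneric, Filter.eventually_all]
  intro σ hσ
  let A : Matrix (Fin d) (Fin d) ℝ := (Matrix.vandermonde fun k => ((σ k : ℕ) : ℝ)).transpose
  let B : Matrix (Fin d) (Fin d) ℝ := Matrix.of fun i k => τ (σ k) i
  let P : Polynomial ℝ := ((Polynomial.X : Polynomial ℝ) • A.map (Polynomial.C (R := ℝ)) +
    B.map (Polynomial.C (R := ℝ))).det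
  have hA : A.det ≠ 0 := by
    rw [Matrix.det_transpose, Matrix.det_vandermonde_ne_zero_iff]
    exact fun k l hkl => hσ (Fin.ext (Nat.cast_injective hkl))
  have hP : P ≠ 0 := fun h0 => hA (by
    rw [← Polynomial.coeff_det_X_add_C_card A B]
    change P.coeff _ = 0
    rw [h0, Polynomial.coeff_zero])
  have hev : ∀ᶠ s : ℝ in nhdsWithin 0 {0}ᶜ, ¬ P.IsRoot s := by
    have hfin : {s | P.IsRoot s}.Finite := Polynomial.finite_setOfPred_isRoot hP
    have := (hfin.subset (Set.sdiff_subset (t := {0}))).isClosed.isOpen_compl.mem_nhds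
      (x := (0 : ℝ)) (by simp)
    filter_upwards [mem_nhdsWithin_of_mem_nhds this, self_mem_nhdsWithin] with s hs hs0 hroot
    exact hs ⟨hroot, hs0⟩
  filter_upwards [hev] with s hs h0
  apply hs
  have : P.eval s = (s • A + B).det := by
    simp only [P]
    rw [← Polynomial.coe_evalRingHom, RingHom.map_det]
    congr 1
    ext i k
    simp [mul_comm (A i k)]
  rw [Polynomial.IsRoot, this, ← h0, Module.Basis.det_apply]
  congr 1
  ext i k
  simp [A, B, p, Module.Basis.toMatrix_apply, Matrix.vandermonde_apply, add_comm]

lemma exists_isGeneric_perturbation {n d : ℕ} (hn : 0 < n) (hd : 0 < d) {ε ε' η : ℝ}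
    (hε : ε < ε') (hη : 0 < η) {τ : Fin n → EuclideanSpace ℝ (Fin d)}
    (hnorm : ∀ j, (1 - ε) * ((d : ℝ) / n) ≤ ‖τ j‖ ^ 2 ∧ ‖τ j‖ ^ 2 ≤ (1 + ε) * ((d : ℝ) / n))
    (hpars : ∀ x : EuclideanSpace ℝ (Fin d), (1 - ε) * ‖x‖ ^ 2 ≤ ∑ j, ⟪x, τ j⟫ ^ 2) :
    ∃ v : Fin n → EuclideanSpace ℝ (Fin d), IsGeneric v ∧
      (∀ j, (1 - ε') * ((d : ℝ) / n) ≤ ‖v j‖ ^ 2 ∧ ‖v j‖ ^ 2 ≤ (1 + ε') * ((d : ℝ) / n)) ∧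
      (∀ x : EuclideanSpace ℝ (Fin d), (1 - ε') * ‖x‖ ^ 2 ≤ ∑ j, ⟪x, v j⟫ ^ 2) ∧
      ∑ j, ‖τ j - v j‖ ^ 2 ≤ η := by
  obtain ⟨p, hp⟩ := exists_forall_eventually_isGeneric_add_smul τ
  have hdn : (0 : ℝ) < d / n := by positivity
  have hlow : ∀ j, ∀ᶠ s : ℝ in nhds 0, (1 - ε') * ((d : ℝ) / n) < ‖τ j + s • p j‖ ^ 2 := by
    intro j
    refine (Continuous.tendsto (by fun_prop) _).eventually (lt_mem_nhds ?_)
    simp only [zero_smul, add_zero]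
    nlinarith [(hnorm j).1]
  have hupp : ∀ j, ∀ᶠ s : ℝ in nhds 0, ‖τ j + s • p j‖ ^ 2 < (1 + ε') * ((d : ℝ) / n) := by
    intro j
    refine (Continuous.tendsto (by fun_prop) _).eventually (gt_mem_nhds ?_)
    simp only [zero_smul, add_zero]
    nlinarith [(hnorm j).2]
  have hdist : ∀ᶠ s : ℝ in nhds 0, ∑ j, ‖τ j - (τ j + s • p j)‖ ^ 2 < η := by
    refine (Continuous.tendsto (by fun_prop) _).eventually (gt_mem_nhds ?_)
    simpa using hη
  have hframe : ∀ᶠ s : ℝ in nhds 0, ∑ j, 2 * |s| * (‖τ j‖ * ‖p j‖) < ε' - ε := by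
    refine (Continuous.tendsto (by fun_prop) _).eventually (gt_mem_nhds ?_)
    simpa using hε
  obtain ⟨s, hs, hl, hu, hds, hf⟩ := (hp.and (((Filter.eventually_all.2 hlow).and
    ((Filter.eventually_all.2 hupp).and (hdist.and hframe))).filter_mono nhdsWithin_le_nhds)).exists
  refine ⟨_, hs, fun j => ⟨(hl j).le, (hu j).le⟩, fun x => ?_, hds.le⟩
  have hterm : ∀ j, ⟪x, τ j⟫ ^ 2 - 2 * |s| * (‖τ j‖ * ‖p j‖) * ‖x‖ ^ 2 ≤
      ⟪x, τ j + s • p j⟫ ^ 2 := by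
    intro j
    rw [inner_add_right, inner_smul_right]
    have h1 : |s * (⟪x, τ j⟫ * ⟪x, p j⟫)| ≤ |s| * ((‖x‖ * ‖τ j‖) * (‖x‖ * ‖p j‖)) := by
      rw [abs_mul, abs_mul]
      gcongr <;> exact abs_real_inner_le_norm _ _
    have h2 := (abs_le.1 h1).1
    nlinarith [sq_nonneg (s * ⟪x, p j⟫)]
  calc (1 - ε') * ‖x‖ ^ 2
      ≤ (1 - ε) * ‖x‖ ^ 2 - (∑ j, 2 * |s| * (‖τ j‖ * ‖p j‖)) * ‖x‖ ^ 2 := by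
        nlinarith [mul_le_mul_of_nonneg_right hf.le (sq_nonneg ‖x‖)]
    _ ≤ ∑ j, ⟪x, τ j⟫ ^ 2 - (∑ j, 2 * |s| * (‖τ j‖ * ‖p j‖)) * ‖x‖ ^ 2 := by
        linarith [hpars x]
    _ = ∑ j, (⟪x, τ j⟫ ^ 2 - 2 * |s| * (‖τ j‖ * ‖p j‖) * ‖x‖ ^ 2) := by
        rw [sum_sub_distrib, sum_mul]
    _ ≤ _ := sum_le_sum fun j _ => hterm j

/-- Unit vectors whose frame operator is bounded below and which can be put in radial isotropic
position are close to a unit norm tight frame. -/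
lemma exists_equal_norm_parseval_of_radial_isotropic {n d : ℕ} [NeZero d] (hn : 0 < n)
    {u : Fin n → EuclideanSpace ℝ (Fin d)} (hu : ∀ i, ‖u i‖ = 1) {δ : ℝ} (hδ : 0 ≤ δ)
    (hlow : ∀ x, (1 - δ) * ((n : ℝ) / d) * ‖x‖ ^ 2 ≤ ∑ i, ⟪x, u i⟫ ^ 2)
    {M : EuclideanSpace ℝ (Fin d) →ₗ[ℝ] EuclideanSpace ℝ (Fin d)} (hM : Function.Injective M)
    (hiso : ∀ x, ∑ i, ⟪x, M (u i)⟫ ^ 2 / ‖M (u i)‖ ^ 2 = (n : ℝ) / d * ‖x‖ ^ 2) :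
    ∃ ω : Fin n → EuclideanSpace ℝ (Fin d),
      (∀ x, ∑ j, ⟪x, ω j⟫ • ω j = x) ∧ (∀ j, ‖ω j‖ ^ 2 = (d : ℝ) / n) ∧
      ∑ j, ‖√((d : ℝ) / n) • u j - ω j‖ ^ 2 ≤ 2 * δ * (d : ℝ) ^ 2 := by
  have hd : (0 : ℝ) < d := Nat.cast_pos.2 (NeZero.pos d)
  have hn' : (0 : ℝ) < n := Nat.cast_pos.2 hn
  have hα : √((d : ℝ) / n) ^ 2 = d / n := Real.sq_sqrt (by positivity)
  obtain ⟨e, f, m, hm, hMe⟩ := exists_orthonormalBasis_map_eq_smul M hM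
  have hr : ∀ i, 0 < ‖M (u i)‖ := fun i => norm_pos_iff.2 fun h0 => by
    have := hM (h0.trans (map_zero M).symm)
    simpa [this] using hu i
  let U := e.equiv f (Equiv.refl _)
  have hUe : ∀ k, U (e k) = f k := fun k => by simp [U]
  let w : Fin n → EuclideanSpace ℝ (Fin d) := fun i => ‖M (u i)‖⁻¹ • U.symm (M (u i))
  have hw : ∀ i, ‖w i‖ = 1 := fun i => by
    simp only [w, norm_smul, norm_inv, norm_norm, LinearIsometryEquiv.norm_map]
    exact inv_mul_cancel₀ (hr i).ne'
  have hwx : ∀ x i, ⟪x, w i⟫ = ⟪U x, M (u i)⟫ / ‖M (u i)‖ := fun x i => by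
    simp only [w, inner_smul_right]
    rw [← U.inner_map_map, U.apply_symm_apply]
    ring
  have hwsum : ∀ x, ∑ i, ⟪x, w i⟫ ^ 2 = (n : ℝ) / d * ‖x‖ ^ 2 := fun x => by
    simp only [hwx, div_pow, hiso, U.norm_map]
  have hwe : ∀ k i, ⟪e k, w i⟫ = m k * ⟪e k, u i⟫ / ‖M (u i)‖ := fun k i => by
    have h1 : ⟪f k, M (u i)⟫ = m k * ⟪e k, u i⟫ := by
      conv_lhs => rw [← e.sum_repr' (u i)]
      simp only [map_sum, map_smul, hMe, inner_sum, inner_smul_right,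
        orthonormal_iff_ite.1 f.orthonormal]
      simp [mul_comm]
    rw [hwx, hUe, h1]
  have hclose : ∑ i, ‖u i - w i‖ ^ 2 ≤ 2 * (δ * n * d) := by
    calc ∑ i, ‖u i - w i‖ ^ 2
        = ∑ i, ∑ k, (⟪e k, u i⟫ - m k * ⟪e k, u i⟫ / ‖M (u i)‖) ^ 2 := by
          refine sum_congr rfl fun i _ => ?_
          rw [← e.sum_sq_inner_right]
          simp only [inner_sub_right, hwe]
      _ ≤ ∑ i, 2 * ∑ k, (strictRank m k : ℝ) *
            ((m k * ⟪e k, u i⟫ / ‖M (u i)‖) ^ 2 - ⟪e k, u i⟫ ^ 2) := by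
          refine sum_le_sum fun i _ => sum_sub_sq_le_sum_strictRank m _ (hr i)
            (fun k => (hm k).le) ?_
          simp only [← hwe]
          rw [e.sum_sq_inner_right, e.sum_sq_inner_right, hw, hu]
      _ = 2 * ∑ k, (strictRank m k : ℝ) * ((n : ℝ) / d - ∑ i, ⟪e k, u i⟫ ^ 2) := by
          rw [← mul_sum, sum_comm]
          congr 1
          refine sum_congr rfl fun k _ => ?_
          rw [← mul_sum, sum_sub_distrib]
          simp only [← hwe, hwsum, e.orthonormal.1, one_pow, mul_one]
      _ ≤ 2 * ∑ k : Fin d, (d : ℝ) * (δ * ((n : ℝ) / d)) := by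
          refine mul_le_mul_of_nonneg_left (sum_le_sum fun k _ => ?_) zero_le_two
          have h1 := hlow (e k)
          rw [e.orthonormal.1] at h1
          have h2 : (strictRank m k : ℝ) ≤ d := by simpa using strictRank_le m k
          calc (strictRank m k : ℝ) * ((n : ℝ) / d - ∑ i, ⟪e k, u i⟫ ^ 2)
              ≤ strictRank m k * (δ * ((n : ℝ) / d)) :=
                mul_le_mul_of_nonneg_left (by linarith) (Nat.cast_nonneg _)
            _ ≤ d * (δ * ((n : ℝ) / d)) := mul_le_mul_of_nonneg_right h2 (by positivity)
      _ = 2 * (δ * n * d) := by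
          rw [sum_const, card_univ, Fintype.card_fin, nsmul_eq_mul]
          field_simp
  refine ⟨fun i => √((d : ℝ) / n) • w i, sum_inner_smul_eq_self_of_forall_sum_inner_sq fun x => ?_,
    fun j => ?_, ?_⟩
  · simp only [inner_smul_right, mul_pow, hα]
    rw [← mul_sum, hwsum]
    field_simp
  · rw [norm_smul, mul_pow, Real.norm_eq_abs, sq_abs, hα, hw, one_pow, mul_one]
  · simp only [← smul_sub, norm_smul, mul_pow, Real.norm_eq_abs, sq_abs, hα]
    rw [← mul_sum]
    calc (d : ℝ) / n * ∑ i, ‖u i - w i‖ ^ 2 ≤ d / n * (2 * (δ * n * d)) := by gcongr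
      _ = 2 * δ * (d : ℝ) ^ 2 := by field_simp

lemma le_card_of_forall_le_sum_inner_sq {n d : ℕ} {τ : Fin n → EuclideanSpace ℝ (Fin d)} {c : ℝ}
    (hc : 0 < c) (h : ∀ x, c * ‖x‖ ^ 2 ≤ ∑ j, ⟪x, τ j⟫ ^ 2) : d ≤ n := by
  let L : EuclideanSpace ℝ (Fin d) →ₗ[ℝ] (Fin n → ℝ) := LinearMap.pi fun j => innerₗ _ (τ j)
  have hL : Function.Injective L := by
    refine (injective_iff_map_eq_zero L).2 fun x hx => ?_
    have h0 : ∀ j, ⟪x, τ j⟫ = 0 := fun j => by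
      rw [real_inner_comm]
      exact congrFun hx j
    have hx2 := h x
    simp only [h0] at hx2
    have : ‖x‖ ^ 2 ≤ 0 := by
      simp at hx2
      nlinarith [sq_nonneg ‖x‖]
    exact norm_eq_zero.1 (pow_eq_zero_iff two_ne_zero |>.1 (le_antisymm this (sq_nonneg _)))
  simpa using LinearMap.finrank_le_finrank_of_injective hL

lemma norm_sub_smul_inv_norm_sq_le {d : ℕ} {v : EuclideanSpace ℝ (Fin d)} (hv : v ≠ 0)
    {a b : ℝ} (ha : 0 ≤ a) (h1 : a - b ≤ ‖v‖ ^ 2) (h2 : ‖v‖ ^ 2 ≤ a + b) :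
    ‖v - √a • (‖v‖⁻¹ • v)‖ ^ 2 ≤ b := by
  have hv' : 0 < ‖v‖ := norm_pos_iff.2 hv
  have hs := Real.sqrt_nonneg a
  have hsq := Real.sq_sqrt ha
  have h3 : v - √a • (‖v‖⁻¹ • v) = (1 - √a * ‖v‖⁻¹) • v := by module
  have h4 : ‖v - √a • (‖v‖⁻¹ • v)‖ ^ 2 = (‖v‖ - √a) ^ 2 := by
    rw [h3, norm_smul, mul_pow, Real.norm_eq_abs, sq_abs, ← mul_pow]
    congr 1
    field_simp
  rw [h4]
  obtain h | h := le_total (√a) ‖v‖ <;> nlinarith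

/-- Hamilton–Moitra Theorem: for every `ε ∈ (0,1)`, positive `n, d`, and every
`ε`-nearly equal norm Parseval frame `(τ_j)_{j=1}^n` for `ℝ^d`, there is an equal norm
Parseval frame `(ω_j)_{j=1}^n` with `∑ j ‖τ_j - ω_j‖² ≤ 20 ε d²`. -/
theorem hamilton_moitra (ε : ℝ) (hε : ε ∈ Set.Ioo (0 : ℝ) 1)
    (n d : ℕ) (hn : 0 < n) (hd : 0 < d)
    (τ : Fin n → EuclideanSpace ℝ (Fin d))
    (hnorm : ∀ j, (1 - ε) * ((d : ℝ) / n) ≤ ‖τ j‖ ^ 2 ∧ ‖τ j‖ ^ 2 ≤ (1 + ε) * ((d : ℝ) / n))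
    (hpars : ∀ x : EuclideanSpace ℝ (Fin d),
      (1 - ε) * ‖x‖ ^ 2 ≤ ∑ j, ⟪x, τ j⟫ ^ 2 ∧
      ∑ j, ⟪x, τ j⟫ ^ 2 ≤ (1 + ε) * ‖x‖ ^ 2) :
    ∃ ω : Fin n → EuclideanSpace ℝ (Fin d),
      (∀ x : EuclideanSpace ℝ (Fin d), ∑ j, ⟪x, ω j⟫ • ω j = x) ∧
      (∀ j, ‖ω j‖ ^ 2 = (d : ℝ) / n) ∧
      ∑ j, ‖τ j - ω j‖ ^ 2 ≤ 20 * ε * (d : ℝ) ^ 2 := by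
  obtain ⟨hε0, hε1⟩ := hε
  have : NeZero d := ⟨hd.ne'⟩
  have hd' : (1 : ℝ) ≤ d := by exact_mod_cast hd
  have hn' : (0 : ℝ) < n := Nat.cast_pos.2 hn
  have hdn : d ≤ n := le_card_of_forall_le_sum_inner_sq (sub_pos.2 hε1) fun x => (hpars x).1
  obtain ⟨v, hv, hvnorm, hvpars, hvτ⟩ := exists_isGeneric_perturbation hn hd
    (show ε < 11 / 10 * ε by linarith) (show 0 < ε / 10 * d by positivity) hnorm
    fun x => (hpars x).1
  set ε' := 11 / 10 * ε with hε'
  have hε'0 : 0 < ε' := by positivity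
  have hv0 : ∀ i, 0 < ‖v i‖ := fun i => norm_pos_iff.2 (hv.ne_zero hdn i)
  obtain ⟨M, hM, hiso⟩ := hv.exists_radial_isotropic hdn
  let u : Fin n → EuclideanSpace ℝ (Fin d) := fun i => ‖v i‖⁻¹ • v i
  have hu : ∀ i, ‖u i‖ = 1 := fun i => by
    simp only [u, norm_smul, norm_inv, norm_norm]
    exact inv_mul_cancel₀ (hv0 i).ne'
  have hlow : ∀ x, (1 - 2 * ε') * ((n : ℝ) / d) * ‖x‖ ^ 2 ≤ ∑ i, ⟪x, u i⟫ ^ 2 := by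
    intro x
    have hpos : 0 < (1 + ε') * ((d : ℝ) / n) := by positivity
    have hterm : ∀ i, ⟪x, v i⟫ ^ 2 / ((1 + ε') * ((d : ℝ) / n)) ≤ ⟪x, u i⟫ ^ 2 := fun i => by
      have : ⟪x, u i⟫ ^ 2 = ⟪x, v i⟫ ^ 2 / ‖v i‖ ^ 2 := by
        simp only [u, inner_smul_right]
        ring
      rw [this]
      exact div_le_div_of_nonneg_left (sq_nonneg _) (pow_pos (hv0 i) 2) (hvnorm i).2
    refine le_trans ?_ (sum_le_sum fun i _ => hterm i)
    rw [← sum_div, le_div_iff₀ hpos]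
    have h1 : (1 - 2 * ε') * ((n : ℝ) / d) * ‖x‖ ^ 2 * ((1 + ε') * ((d : ℝ) / n)) =
        (1 - 2 * ε') * (1 + ε') * ‖x‖ ^ 2 := by field_simp
    rw [h1]
    exact le_trans (mul_le_mul_of_nonneg_right (by nlinarith) (sq_nonneg _)) (hvpars x)
  have hisou : ∀ x, ∑ i, ⟪x, M (u i)⟫ ^ 2 / ‖M (u i)‖ ^ 2 = (n : ℝ) / d * ‖x‖ ^ 2 := by
    intro x
    rw [← hiso x]
    refine sum_congr rfl fun i _ => ?_
    have := (hv0 i).ne'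
    simp only [u, map_smul, inner_smul_right, norm_smul, norm_inv, norm_norm, mul_pow]
    exact mul_div_mul_left _ _ (by positivity)
  obtain ⟨ω, hω, hωnorm, hωu⟩ := exists_equal_norm_parseval_of_radial_isotropic hn hu
    (δ := 2 * ε') (by positivity) hlow hM hisou
  refine ⟨ω, hω, hωnorm, ?_⟩
  have hvu : ∑ j, ‖v j - √((d : ℝ) / n) • u j‖ ^ 2 ≤ ε' * d := by
    calc ∑ j, ‖v j - √((d : ℝ) / n) • u j‖ ^ 2 ≤ ∑ _j : Fin n, ε' * ((d : ℝ) / n) :=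
          sum_le_sum fun j _ => norm_sub_smul_inv_norm_sq_le (hv.ne_zero hdn j) (by positivity)
            (by linarith [(hvnorm j).1]) (by linarith [(hvnorm j).2])
      _ = ε' * d := by
          rw [sum_const, card_univ, Fintype.card_fin, nsmul_eq_mul]
          field_simp
  have htri : ∀ j, ‖τ j - ω j‖ ^ 2 ≤ 3 * (‖τ j - v j‖ ^ 2 +
      ‖v j - √((d : ℝ) / n) • u j‖ ^ 2 + ‖√((d : ℝ) / n) • u j - ω j‖ ^ 2) := by
    intro j
    have h1 : ‖τ j - ω j‖ ≤ ‖τ j - v j‖ + ‖v j - √((d : ℝ) / n) • u j‖ +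
        ‖√((d : ℝ) / n) • u j - ω j‖ := by
      refine (norm_sub_le_norm_sub_add_norm_sub _ (√((d : ℝ) / n) • u j) _).trans ?_
      gcongr
      exact norm_sub_le_norm_sub_add_norm_sub _ _ _
    refine (pow_le_pow_left₀ (norm_nonneg _) h1 2).trans ?_
    nlinarith [sq_nonneg (‖τ j - v j‖ - ‖v j - √((d : ℝ) / n) • u j‖),
      sq_nonneg (‖τ j - v j‖ - ‖√((d : ℝ) / n) • u j - ω j‖),
      sq_nonneg (‖v j - √((d : ℝ) / n) • u j‖ - ‖√((d : ℝ) / n) • u j - ω j‖)]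
  calc ∑ j, ‖τ j - ω j‖ ^ 2
      ≤ 3 * (∑ j, ‖τ j - v j‖ ^ 2 + ∑ j, ‖v j - √((d : ℝ) / n) • u j‖ ^ 2 +
          ∑ j, ‖√((d : ℝ) / n) • u j - ω j‖ ^ 2) := by
        rw [← sum_add_distrib, ← sum_add_distrib, mul_sum]
        exact sum_le_sum fun j _ => htri j
    _ ≤ 3 * (ε / 10 * d + ε' * d + 2 * (2 * ε') * (d : ℝ) ^ 2) := by gcongr
    _ ≤ 20 * ε * (d : ℝ) ^ 2 := by
        rw [hε']
        nlinarith [mul_nonneg hε0.le (mul_nonneg (zero_le_one.trans hd') (sub_nonneg.2 hd')),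
          mul_pos hε0 (pow_pos (zero_lt_one.trans_le hd') 2)]
end
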